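/- arXiv:2310.18880 — 8 statements merged into one kernel-verified Lean document; each statement's English description precedes it below -/
import Mathlib

section
/- Let L be an odd prime and N a natural number with N ≤ (L−1)/2. For a subset A of {−(L−1)/2, …, (L−1)/2} with |A| = N and θ ∈ ℝ, define E_A(θ) = 2 Σ_{ν∈A} cos(2πν/L + θ). Then the set of θ ∈ [0, 2π) for which there exist two distinct subsets A ≠ B of {−(L−1)/2, …, (L−1)/2} with |A| = |B| = N and E_A(θ) = E_B(θ) is a finite set. -/
open Finset

/-- A nonzero real linear combination of `cos` and `sin`, written as `Re (w * exp (θ * I))`, has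
finitely many zeros in `[0, 2π)`. -/
theorem finite_setOf_re_mul_exp_eq_zero {w : ℂ} (hw : w ≠ 0) :
    {θ : ℝ | θ ∈ Set.Ico 0 (2 * Real.pi) ∧ (w * Complex.exp (θ * Complex.I)).re = 0}.Finite := by
  refine ((Set.finite_Icc (-2 : ℤ) 3).image
    fun k : ℤ => (2 * k + 1) * Real.pi / 2 - w.arg).subset ?_
  rintro θ ⟨⟨h0, h1⟩, h⟩
  have hre : (w * Complex.exp (θ * Complex.I)).re = ‖w‖ * Real.cos (θ + w.arg) := by
    conv_lhs => rw [← Complex.norm_mul_exp_arg_mul_I w]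
    rw [mul_assoc, ← Complex.exp_add, ← add_mul, Complex.re_ofReal_mul, ← Complex.ofReal_add,
      Complex.exp_ofReal_mul_I_re, add_comm]
  rw [hre, mul_eq_zero, norm_eq_zero, or_iff_right hw, Real.cos_eq_zero_iff] at h
  obtain ⟨k, hk⟩ := h
  have hpi := Real.pi_pos
  have hl := Complex.neg_pi_lt_arg w
  have hu := Complex.arg_le_pi w
  refine ⟨k, ⟨?_, ?_⟩, by simp only; linarith⟩
  · have : (-3 : ℝ) < k := by
      by_contra! hc
      nlinarith
    have : (-3 : ℤ) < k := by exact_mod_cast this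
    lia
  · have : (k : ℝ) < 4 := by
      by_contra! hc
      nlinarith
    have : k < 4 := by exact_mod_cast this
    lia

/-- For an odd prime `p`, a set of integers of given size in the symmetric residue system modulo `p`
is determined by the sum of the corresponding powers of a primitive `p`-th root of unity. -/
theorem IsPrimitiveRoot.eq_of_sum_zpow_eq {p : ℕ} (hp : p.Prime) (hodd : Odd p) {ζ : ℂ}
    (hζ : IsPrimitiveRoot ζ p) {A B : Finset ℤ}
    (hA : A ⊆ Finset.Icc (-(((p : ℤ) - 1) / 2)) (((p : ℤ) - 1) / 2))
    (hB : B ⊆ Finset.Icc (-(((p : ℤ) - 1) / 2)) (((p : ℤ) - 1) / 2))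
    (hcard : A.card = B.card) (h : ∑ ν ∈ A, ζ ^ ν = ∑ ν ∈ B, ζ ^ ν) : A = B := by
  obtain ⟨m, rfl⟩ := hodd
  have hm : (((2 * m + 1 : ℕ) : ℤ) - 1) / 2 = m := by push_cast; lia
  rw [hm] at hA hB
  have hζ0 : ζ ≠ 0 := hζ.ne_zero hp.ne_zero
  have sum_eq : ∀ {R : Type} [AddCommMonoid R] (S : Finset ℤ) (f : ℤ → R),
      S ⊆ Finset.Icc (-(m : ℤ)) m →
      ∑ ν ∈ S, f ν = ∑ j : Fin (2 * m + 1), if (j : ℤ) - m ∈ S then f ((j : ℤ) - m) else 0 := by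
    intro R _ S f hS
    rw [← Finset.sum_filter]
    symm
    refine Finset.sum_bij (fun j _ => (j : ℤ) - m) (by simp) ?_ ?_ (by simp)
    · intro i _ j _ hij
      ext
      lia
    · intro ν hν
      have := Finset.mem_Icc.1 (hS hν)
      refine ⟨⟨(ν + m).toNat, by lia⟩, ?_, ?_⟩
      · have : ((ν + m).toNat : ℤ) - m = ν := by lia
        exact Finset.mem_filter.2 ⟨Finset.mem_univ _, this.symm ▸ hν⟩
      · simp only
        lia
  set α : Fin (2 * m + 1) → ℤ := fun j =>
    (if (j : ℤ) - m ∈ A then 1 else 0) - (if (j : ℤ) - m ∈ B then 1 else 0) with hα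
  have hsum : ∑ j, α j = 0 := by
    rw [hα, Finset.sum_sub_distrib, ← sum_eq A (fun _ => (1 : ℤ)) hA,
      ← sum_eq B (fun _ => (1 : ℤ)) hB]
    simp [hcard]
  have hroot : ∑ j, (α j : ℂ) * ζ ^ (j : ℕ) = 0 := by
    rw [sum_eq A _ hA, sum_eq B _ hB, ← sub_eq_zero, ← Finset.sum_sub_distrib] at h
    have h' := congrArg (ζ ^ (m : ℤ) * ·) h
    simp only [mul_zero, Finset.mul_sum] at h'
    rw [← h']
    refine Finset.sum_congr rfl fun j _ => ?_
    have hj : ζ ^ (m : ℤ) * ζ ^ ((j : ℤ) - m) = ζ ^ (j : ℕ) := by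
      rw [← zpow_add₀ hζ0, add_sub_cancel, zpow_natCast]
    rw [← hj]
    simp only [hα]
    split_ifs <;> simp
  have hconst := (hζ.sum_eq_zero_iff_forall_eq_int hp α).1 hroot
  have hzero : ∀ j, α j = 0 := by
    intro j
    have : ∑ i, α i = (2 * m + 1 : ℕ) * α j := by
      rw [Finset.sum_congr rfl fun i _ => hconst i j]
      simp
    rw [hsum] at this
    exact (mul_eq_zero.1 this.symm).resolve_left (by exact_mod_cast hp.ne_zero)
  ext ν
  by_cases hν : ν ∈ Finset.Icc (-(m : ℤ)) m
  · have := Finset.mem_Icc.1 hν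
    have h0 := hzero ⟨(ν + m).toNat, by lia⟩
    have he : ((ν + m).toNat : ℤ) - m = ν := by lia
    simp only [hα, he] at h0
    split_ifs at h0 <;> simp_all
  · exact iff_of_false (fun h => hν (hA h)) (fun h => hν (hB h))

/-- A sum of cosines at the momenta `2πν/L`, shifted by a common phase, as a real part. -/
theorem sum_cos_eq_re (L : ℕ) (A : Finset ℤ) (θ : ℝ) :
    ∑ ν ∈ A, Real.cos (2 * Real.pi * ν / L + θ) =
      ((∑ ν ∈ A, Complex.exp (2 * Real.pi * Complex.I / L) ^ ν) *
        Complex.exp (θ * Complex.I)).re := by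
  rw [Finset.sum_mul, Complex.re_sum]
  refine Finset.sum_congr rfl fun ν _ => ?_
  rw [← Complex.exp_int_mul, ← Complex.exp_add, ← Complex.exp_ofReal_mul_I_re]
  congr 2
  push_cast
  ring



/-- Let `L` be an odd prime and `N ≤ (L-1)/2`. For
`A ⊆ {-(L-1)/2, …, (L-1)/2}` with `|A| = N` and `θ ∈ ℝ`, let
`E_A(θ) = 2 ∑_{ν∈A} cos(2πν/L + θ)`. The set of `θ ∈ [0, 2π)` at which two distinct
configurations have equal energies is finite. -/
theorem degenerate_phases_finite
    (L N : ℕ) (hL : Nat.Prime L) (hodd : Odd L) (hN : N ≤ (L - 1) / 2) :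
    {θ : ℝ | θ ∈ Set.Ico 0 (2 * Real.pi) ∧
      ∃ A B : Finset ℤ,
        A ⊆ Finset.Icc (-(((L : ℤ) - 1) / 2)) (((L : ℤ) - 1) / 2) ∧
        B ⊆ Finset.Icc (-(((L : ℤ) - 1) / 2)) (((L : ℤ) - 1) / 2) ∧
        A.card = N ∧ B.card = N ∧ A ≠ B ∧
        2 * ∑ ν ∈ A, Real.cos (2 * Real.pi * ν / L + θ) =
          2 * ∑ ν ∈ B, Real.cos (2 * Real.pi * ν / L + θ)}.Finite := by
  set I := Finset.Icc (-(((L : ℤ) - 1) / 2)) (((L : ℤ) - 1) / 2)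
  set z : Finset ℤ → ℂ := fun A => ∑ ν ∈ A, Complex.exp (2 * Real.pi * Complex.I / L) ^ ν
  have hfin : (⋃ P ∈ {P : Finset ℤ × Finset ℤ | P ∈ I.powerset ×ˢ I.powerset ∧ z P.1 - z P.2 ≠ 0},
      {θ : ℝ | θ ∈ Set.Ico 0 (2 * Real.pi) ∧
        ((z P.1 - z P.2) * Complex.exp (θ * Complex.I)).re = 0}).Finite :=
    ((I.powerset ×ˢ I.powerset).finite_toSet.subset fun P hP => hP.1).biUnion
      fun P hP => finite_setOf_re_mul_exp_eq_zero hP.2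
  refine hfin.subset ?_
  rintro θ ⟨hθ, A, B, hA, hB, hAN, hBN, hne, hE⟩
  refine Set.mem_biUnion (x := (A, B)) ⟨by simp [hA, hB], fun h => hne ?_⟩ ⟨hθ, ?_⟩
  · exact (Complex.isPrimitiveRoot_exp L hL.ne_zero).eq_of_sum_zpow_eq hL hodd hA hB
      (hAN.trans hBN.symm) (sub_eq_zero.1 h)
  · rw [sum_cos_eq_re, sum_cos_eq_re] at hE
    rw [sub_mul, Complex.sub_re]
    linarith
end

section
/- Let L be an odd prime and N a natural number with 1 ≤ N ≤ (L−1)/4. For a subset A of {−(L−1)/2, …, (L−1)/2} with |A| = N and θ ∈ ℝ, define E_A(θ) = 2 Σ_{ν∈A} cos(2πν/L + θ). Then for every θ ≠ 0 with |θ| ≤ (4N)^{−(L−1)/2}, and every pair of distinct subsets A ≠ B of {−(L−1)/2, …, (L−1)/2} with |A| = |B| = N, one has E_A(θ) ≠ E_B(θ). -/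
open Finset

open Polynomial in
/-- The only vanishing difference of two sums of distinct `L`-th roots of unity with equally many
terms, `L` prime, is the trivial one. -/
theorem finset_eq_of_sum_primitiveRoot_pow_eq {L : ℕ} (hL : L.Prime) {ω : ℂ}
    (hω : IsPrimitiveRoot ω L) {S T : Finset ℕ} (hS : ∀ i ∈ S, i < L) (hT : ∀ i ∈ T, i < L)
    (hcard : S.card = T.card) (h : ∑ i ∈ S, ω ^ i = ∑ i ∈ T, ω ^ i) : S = T := by
  set P : ℚ[X] := ∑ i ∈ S, X ^ i - ∑ i ∈ T, X ^ i with hP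
  have hdeg : P.degree < L := by
    refine (degree_sub_le _ _).trans_lt (max_lt ?_ ?_)
    · refine (degree_sum_le _ _).trans_lt ?_
      simpa [Finset.sup_lt_iff] using hS
    · refine (degree_sum_le _ _).trans_lt ?_
      simpa [Finset.sup_lt_iff] using hT
  have h1 : cyclotomic 1 ℚ ∣ P := by
    rw [cyclotomic_one, ← C_1, dvd_iff_isRoot]
    simp [hP, eval_finsetSum, hcard]
  have h2 : cyclotomic L ℚ ∣ P := by
    rw [cyclotomic_eq_minpoly_rat hω hL.pos]
    refine minpoly.dvd _ _ ?_
    simp [hP, h]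
  have h3 : (X ^ L - 1 : ℚ[X]) ∣ P := by
    have := (cyclotomic.isCoprime_rat hL.one_lt.ne').mul_dvd h2 h1
    have hprime := Fact.mk hL
    rwa [cyclotomic_one, cyclotomic_prime_mul_X_sub_one] at this
  have h0 : P = 0 := by
    refine eq_zero_of_dvd_of_degree_lt h3 ?_
    rwa [← C_1, degree_X_pow_sub_C hL.pos]
  ext j
  have hj : P.coeff j = 0 := by rw [h0, coeff_zero]
  simp only [hP, coeff_sub, finsetSum_coeff, coeff_X_pow, Finset.sum_ite_eq] at hj
  by_cases hjS : j ∈ S <;> by_cases hjT : j ∈ T <;> simp_all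

/-- Version of `finset_eq_of_sum_primitiveRoot_pow_eq` for integer exponents in a window of
length `L`. -/
theorem finset_eq_of_sum_primitiveRoot_zpow_eq {L : ℕ} (hL : L.Prime) {ω : ℂ}
    (hω : IsPrimitiveRoot ω L) (h : ℤ) {A B : Finset ℤ}
    (hA : ∀ ν ∈ A, 0 ≤ ν + h ∧ ν + h < L) (hB : ∀ ν ∈ B, 0 ≤ ν + h ∧ ν + h < L)
    (hcard : A.card = B.card) (hsum : ∑ ν ∈ A, ω ^ ν = ∑ ν ∈ B, ω ^ ν) : A = B := by
  classical
  have hω0 : ω ≠ 0 := hω.ne_zero hL.ne_zero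
  have hinj : ∀ C : Finset ℤ, (∀ ν ∈ C, 0 ≤ ν + h ∧ ν + h < L) →
      Set.InjOn (fun ν : ℤ => (ν + h).toNat) C := by
    intro C hC x hx y hy hxy
    have := hC x hx
    have := hC y hy
    change (x + h).toNat = (y + h).toNat at hxy
    omega
  have himage : ∀ C : Finset ℤ, (∀ ν ∈ C, 0 ≤ ν + h ∧ ν + h < L) →
      ∑ i ∈ C.image (fun ν : ℤ => (ν + h).toNat), ω ^ i = (∑ ν ∈ C, ω ^ ν) * ω ^ h := by
    intro C hC
    rw [Finset.sum_image (hinj C hC), Finset.sum_mul]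
    refine Finset.sum_congr rfl fun ν hν => ?_
    rw [← zpow_natCast, Int.toNat_of_nonneg (hC ν hν).1, zpow_add₀ hω0]
  have hbound : ∀ C : Finset ℤ, (∀ ν ∈ C, 0 ≤ ν + h ∧ ν + h < L) →
      ∀ i ∈ C.image (fun ν : ℤ => (ν + h).toNat), i < L := by
    intro C hC i hi
    obtain ⟨ν, hν, rfl⟩ := Finset.mem_image.1 hi
    have := hC ν hν
    omega
  have key := finset_eq_of_sum_primitiveRoot_pow_eq hL hω (hbound A hA) (hbound B hB)
    (by rw [Finset.card_image_of_injOn (hinj A hA), Finset.card_image_of_injOn (hinj B hB), hcard])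
    (by rw [himage A hA, himage B hB, hsum])
  have hsub : ∀ C D : Finset ℤ, (∀ ν ∈ C, 0 ≤ ν + h ∧ ν + h < L) →
      (∀ ν ∈ D, 0 ≤ ν + h ∧ ν + h < L) →
      C.image (fun ν : ℤ => (ν + h).toNat) = D.image (fun ν : ℤ => (ν + h).toNat) → C ⊆ D := by
    intro C D hC hD hCD ν hν
    have hmem := Finset.mem_image_of_mem (fun ν : ℤ => (ν + h).toNat) hν
    rw [hCD] at hmem
    obtain ⟨μ, hμ, hμν⟩ := Finset.mem_image.1 hmem
    have := hC ν hν
    have := hD μ hμ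
    have : μ = ν := by
      change (μ + h).toNat = (ν + h).toNat at hμν
      omega
    exact this ▸ hμ
  exact (hsub A B hA hB key).antisymm (hsub B A hB hA key.symm)

/-- The difference of the sums of `x ^ ν + x ^ (-ν)` over `A` and over `B`. -/
noncomputable def symmetricDiffSum {K : Type*} [Field K] (A B : Finset ℤ) (x : K) : K :=
  ∑ ν ∈ A, (x ^ ν + x ^ (-ν)) - ∑ ν ∈ B, (x ^ ν + x ^ (-ν))

theorem symmetricDiffSum_inv {K : Type*} [Field K] (A B : Finset ℤ) (x : K) :
    symmetricDiffSum A B x⁻¹ = symmetricDiffSum A B x := by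
  simp [symmetricDiffSum, add_comm]

theorem map_symmetricDiffSum {K M F : Type*} [Field K] [Field M] [FunLike F K M]
    [RingHomClass F K M] (σ : F) (A B : Finset ℤ) (x : K) :
    σ (symmetricDiffSum A B x) = symmetricDiffSum A B (σ x) := by
  simp [symmetricDiffSum, map_zpow₀]

theorem isIntegral_symmetricDiffSum {K : Type*} [Field K] {L : ℕ} (hL : 0 < L) {x : K}
    (hx : x ^ L = 1) (A B : Finset ℤ) : IsIntegral ℤ (symmetricDiffSum A B x) := by
  have hpow : ∀ ν : ℤ, IsIntegral ℤ (x ^ ν) := fun ν => by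
    refine IsIntegral.of_pow hL ?_
    rw [← zpow_natCast, ← zpow_mul, mul_comm, zpow_mul, zpow_natCast, hx, one_zpow]
    exact isIntegral_one
  exact (IsIntegral.sum _ fun ν _ => (hpow ν).add (hpow _)).sub
    (IsIntegral.sum _ fun ν _ => (hpow ν).add (hpow _))

theorem norm_symmetricDiffSum_le {A B : Finset ℤ} {N : ℕ} (hA : A.card = N) (hB : B.card = N)
    {x : ℂ} (hx : ‖x‖ = 1) : ‖symmetricDiffSum A B x‖ ≤ 4 * N := by
  have hC : ∀ C : Finset ℤ, C.card = N → ‖∑ ν ∈ C, (x ^ ν + x ^ (-ν))‖ ≤ 2 * N := by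
    intro C hC
    refine (norm_sum_le_of_le C (n := fun _ => (2 : ℝ)) fun ν _ => ?_).trans ?_
    · refine (norm_add_le _ _).trans ?_
      simp only [norm_zpow, hx, one_zpow]
      norm_num
    · simp [hC, mul_comm]
  have := norm_sub_le (∑ ν ∈ A, (x ^ ν + x ^ (-ν))) (∑ ν ∈ B, (x ^ ν + x ^ (-ν)))
  have := hC A hA
  have := hC B hB
  unfold symmetricDiffSum
  linarith

/-- Liouville-type lower bound: the norm of a nonzero algebraic integer is at least one, and a
symmetric sum takes the same value at the two conjugate embeddings. -/
theorem one_le_norm_symmetricDiffSum (K : Type*) [Field K] [Algebra ℚ K] {L N : ℕ}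
    [IsCyclotomicExtension {L} ℚ K] (hL : L.Prime) (hL2 : 2 < L) {ω : ℂ}
    (hω : IsPrimitiveRoot ω L) {A B : Finset ℤ} (hA : A.card = N) (hB : B.card = N)
    (hne : symmetricDiffSum A B ω ≠ 0) :
    1 ≤ ‖symmetricDiffSum A B ω‖ ^ 2 * (4 * N : ℝ) ^ (L - 3) := by
  classical
  have : FiniteDimensional ℚ K := IsCyclotomicExtension.finiteDimensional {L} ℚ K
  have : NeZero L := ⟨hL.ne_zero⟩
  have hζ : IsPrimitiveRoot (IsCyclotomicExtension.zeta L ℚ K) L :=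
    IsCyclotomicExtension.zeta_spec L ℚ K
  set ζ := IsCyclotomicExtension.zeta L ℚ K
  have hirr : Irreducible (Polynomial.cyclotomic L ℚ) := Polynomial.cyclotomic.irreducible_rat hL.pos
  let e := hζ.embeddingsEquivPrimitiveRoots ℂ hirr
  have he : ∀ ξ, ((e.symm ξ) ζ : ℂ) = ξ := fun ξ => by
    conv_rhs => rw [← e.apply_symm_apply ξ]
    rfl
  have hmem : ω ∈ primitiveRoots L ℂ := (mem_primitiveRoots hL.pos).2 hω
  have hmem' : ω⁻¹ ∈ primitiveRoots L ℂ := (mem_primitiveRoots hL.pos).2 hω.inv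
  set σ := e.symm ⟨ω, hmem⟩ with hσ
  set τ := e.symm ⟨ω⁻¹, hmem'⟩ with hτ
  have hστ : σ ≠ τ := by
    intro h
    have h1 : ω = ω⁻¹ := congrArg Subtype.val (e.symm.injective h)
    have h2 : ω ^ 2 = 1 := by
      rw [pow_two]
      nth_rewrite 2 [h1]
      exact mul_inv_cancel₀ (hω.ne_zero hL.ne_zero)
    exact absurd (Nat.le_of_dvd two_pos (hω.dvd_of_pow_eq_one 2 h2)) (by omega)
  set α : K := symmetricDiffSum A B ζ with hα
  have hσα : σ α = symmetricDiffSum A B ω := by rw [hα, map_symmetricDiffSum, hσ, he]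
  have hτα : τ α = symmetricDiffSum A B ω := by
    rw [hα, map_symmetricDiffSum, hτ, he, symmetricDiffSum_inv]
  have hα0 : α ≠ 0 := fun h => hne (by rw [← hσα, h, map_zero])
  have hle : ∀ ρ : K →ₐ[ℚ] ℂ, ‖ρ α‖ ≤ 4 * N := fun ρ => by
    rw [hα, map_symmetricDiffSum]
    refine norm_symmetricDiffSum_le hA hB (Complex.norm_eq_one_of_pow_eq_one (n := L) ?_ hL.ne_zero)
    rw [← map_pow, hζ.pow_eq_one, map_one]
  have hint : IsIntegral ℤ α := isIntegral_symmetricDiffSum hL.pos hζ.pow_eq_one A B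
  have hnorm : 1 ≤ ∏ ρ : K →ₐ[ℚ] ℂ, ‖ρ α‖ := by
    obtain ⟨n, hn⟩ := IsIntegrallyClosed.isIntegral_iff.1 (Algebra.isIntegral_norm ℚ hint)
    have hn0 : n ≠ 0 := by
      rintro rfl
      exact hα0 (Algebra.norm_eq_zero_iff.1 (by rw [← hn, map_zero]))
    have h1 := Algebra.norm_eq_prod_embeddings ℚ ℂ α
    rw [← norm_prod, ← h1, ← hn]
    simpa using (by exact_mod_cast Int.one_le_abs hn0 : (1 : ℝ) ≤ |(n : ℝ)|)
  have hcardK : Fintype.card (K →ₐ[ℚ] ℂ) = L - 1 := by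
    rw [Fintype.card_congr e, Fintype.card_coe, hω.card_primitiveRoots, Nat.totient_prime hL]
  refine hnorm.trans ?_
  rw [← Finset.mul_prod_erase _ _ (Finset.mem_univ σ), ← Finset.mul_prod_erase _ _
    (Finset.mem_erase.2 ⟨hστ.symm, Finset.mem_univ τ⟩), hσα, hτα, ← mul_assoc, ← pow_two]
  refine mul_le_mul_of_nonneg_left ?_ (by positivity)
  refine (Finset.prod_le_prod (fun _ _ => norm_nonneg _) fun ρ _ => hle ρ).trans ?_
  rw [Finset.prod_const, Finset.card_erase_of_mem (Finset.mem_erase.2 ⟨hστ.symm, mem_univ τ⟩),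
    Finset.card_erase_of_mem (mem_univ σ), Finset.card_univ, hcardK]
  exact le_of_eq (congrArg _ (by omega))

/-- `Re (e^{iθ} z) = 0` means that `z` is orthogonal to a unit vector. -/
theorem abs_re_eq_norm_mul_abs_sin {z : ℂ} {θ : ℝ}
    (h : z.re * Real.cos θ = z.im * Real.sin θ) : |z.re| = ‖z‖ * |Real.sin θ| := by
  rw [← abs_norm z, ← abs_mul]
  refine sq_eq_sq_iff_abs_eq_abs _ _ |>.1 ?_
  rw [mul_pow, Complex.sq_norm, Complex.normSq_apply]
  linear_combination (z.re * Real.cos θ + z.im * Real.sin θ) * h -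
    z.re ^ 2 * Real.sin_sq_add_cos_sq θ

/-- Let `L` be an odd prime and `1 ≤ N ≤ (L-1)/4`. For every phase
`θ ≠ 0` with `|θ| ≤ (4N)^{-(L-1)/2}` and every pair of distinct configurations
`A ≠ B ⊆ {-(L-1)/2, …, (L-1)/2}` with `|A| = |B| = N`, the energies
`E_A(θ) = 2 ∑_{ν∈A} cos(2πν/L + θ)` and `E_B(θ)` differ. -/
theorem nondegenerate_for_small_phase
    (L N : ℕ) (hL : Nat.Prime L) (hodd : Odd L) (hN1 : 1 ≤ N) (hN : N ≤ (L - 1) / 4)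
    (θ : ℝ) (hθ : θ ≠ 0) (hθsmall : |θ| ≤ (((4 * N : ℕ) : ℝ) ^ ((L - 1) / 2 : ℕ))⁻¹)
    (A B : Finset ℤ)
    (hA : A ⊆ Finset.Icc (-(((L : ℤ) - 1) / 2)) (((L : ℤ) - 1) / 2))
    (hB : B ⊆ Finset.Icc (-(((L : ℤ) - 1) / 2)) (((L : ℤ) - 1) / 2))
    (hAcard : A.card = N) (hBcard : B.card = N) (hAB : A ≠ B) :
    2 * ∑ ν ∈ A, Real.cos (2 * Real.pi * ν / L + θ) ≠
      2 * ∑ ν ∈ B, Real.cos (2 * Real.pi * ν / L + θ) := by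
  intro heq
  have hL2 : 2 < L := by
    obtain ⟨k, hk⟩ := hodd
    have := hL.two_le
    omega
  have hN0 : (1 : ℝ) ≤ N := by exact_mod_cast hN1
  set ω : ℂ := Complex.exp (2 * Real.pi * Complex.I / L) with hωdef
  have hω : IsPrimitiveRoot ω L := Complex.isPrimitiveRoot_exp L hL.ne_zero
  have hω1 : ‖ω‖ = 1 := Complex.norm_eq_one_of_pow_eq_one hω.pow_eq_one hL.ne_zero
  have hpow : ∀ ν : ℤ, ω ^ ν = Complex.exp ((2 * Real.pi * ν / L : ℝ) * Complex.I) := fun ν => by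
    rw [hωdef, ← Complex.exp_int_mul]
    congr 1
    push_cast
    ring
  have hre : ∀ ν : ℤ, (ω ^ ν).re = Real.cos (2 * Real.pi * ν / L) := fun ν => by
    rw [hpow, Complex.exp_ofReal_mul_I_re]
  have him : ∀ ν : ℤ, (ω ^ ν).im = Real.sin (2 * Real.pi * ν / L) := fun ν => by
    rw [hpow, Complex.exp_ofReal_mul_I_im]
  set z : ℂ := ∑ ν ∈ A, ω ^ ν - ∑ ν ∈ B, ω ^ ν with hz
  have hz0 : z ≠ 0 := fun h => by
    have hwindow : ∀ C ⊆ Finset.Icc (-(((L : ℤ) - 1) / 2)) (((L : ℤ) - 1) / 2),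
        ∀ ν ∈ C, 0 ≤ ν + ((L : ℤ) - 1) / 2 ∧ ν + ((L : ℤ) - 1) / 2 < L := by
      intro C hC ν hν
      have := Finset.mem_Icc.1 (hC hν)
      omega
    exact hAB (finset_eq_of_sum_primitiveRoot_zpow_eq hL hω (((L : ℤ) - 1) / 2)
      (hwindow A hA) (hwindow B hB) (hAcard.trans hBcard.symm) (sub_eq_zero.1 h))
  have horth : z.re * Real.cos θ = z.im * Real.sin θ := by
    have hC : ∀ C : Finset ℤ, ∑ ν ∈ C, Real.cos (2 * Real.pi * ν / L + θ) =
        (∑ ν ∈ C, ω ^ ν).re * Real.cos θ - (∑ ν ∈ C, ω ^ ν).im * Real.sin θ := fun C => by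
      simp only [Real.cos_add, Finset.sum_sub_distrib, Complex.re_sum, Complex.im_sum, hre, him,
        Finset.sum_mul]
    rw [hC, hC] at heq
    rw [hz, Complex.sub_re, Complex.sub_im]
    linarith
  have hzre := abs_re_eq_norm_mul_abs_sin horth
  have hznorm : ‖z‖ ≤ 2 * N := by
    have hC : ∀ C : Finset ℤ, C.card = N → ‖∑ ν ∈ C, ω ^ ν‖ ≤ N := fun C hC => by
      refine (norm_sum_le _ _).trans ?_
      simp [hω1, hC]
    have := norm_sub_le (∑ ν ∈ A, ω ^ ν) (∑ ν ∈ B, ω ^ ν)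
    linarith [hC A hAcard, hC B hBcard]
  have hsym : symmetricDiffSum A B ω = ((2 * z.re : ℝ) : ℂ) := by
    have hconj : ∀ ν : ℤ, ω ^ ν + ω ^ (-ν) = ((2 * (ω ^ ν).re : ℝ) : ℂ) := fun ν => by
      rw [zpow_neg, Complex.inv_eq_conj (by rw [norm_zpow, hω1, one_zpow]), Complex.add_conj]
    simp only [symmetricDiffSum, hconj]
    rw [hz, Complex.sub_re, Complex.re_sum, Complex.re_sum]
    push_cast
    rw [mul_sub, Finset.mul_sum, Finset.mul_sum]
  have hq1 : (1 : ℝ) < 4 * N := by linarith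
  obtain ⟨m, hm⟩ : ∃ m, (L - 1) / 2 = m + 1 := ⟨(L - 1) / 2 - 1, by omega⟩
  have hm2 : L - 3 = m * 2 := by
    obtain ⟨k, hk⟩ := hodd
    omega
  rw [hm] at hθsmall
  push_cast at hθsmall
  have hθlt : |θ| < 1 :=
    hθsmall.trans_lt (inv_lt_one_of_one_lt₀ (one_lt_pow₀ hq1 (Nat.succ_ne_zero m)))
  have hsin0 : Real.sin θ ≠ 0 := by
    have := abs_lt.1 hθlt
    have := Real.pi_gt_three
    intro h
    exact hθ ((Real.sin_eq_zero_iff_of_lt_of_lt (by linarith) (by linarith)).1 h)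
  have hsym0 : symmetricDiffSum A B ω ≠ 0 := by
    rw [hsym, Complex.ofReal_ne_zero]
    have : 0 < |z.re| := by
      rw [hzre]
      exact mul_pos (norm_pos_iff.2 hz0) (abs_pos.2 hsin0)
    exact mul_ne_zero two_ne_zero (abs_pos.1 this)
  have : NeZero L := ⟨hL.ne_zero⟩
  have hcyc := CyclotomicField.isCyclotomicExtension L ℚ
  have hlower := @one_le_norm_symmetricDiffSum (CyclotomicField L ℚ) _ (CyclotomicField.algebra L ℚ)
    _ _ hcyc hL hL2 _ hω _ _ hAcard hBcard hsym0
  rw [hm2, pow_mul, ← mul_pow, hsym, Complex.norm_real, Real.norm_eq_abs, abs_mul, abs_two,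
    hzre] at hlower
  have hsinlt : |Real.sin θ| < |θ| := Real.abs_sin_lt_abs hθ
  refine hlower.not_gt (pow_lt_one₀ (by positivity) ?_ two_ne_zero)
  calc 2 * (‖z‖ * |Real.sin θ|) * (4 * N : ℝ) ^ m
      ≤ 2 * (2 * N * |Real.sin θ|) * (4 * N : ℝ) ^ m := by gcongr
    _ < 2 * (2 * N * |θ|) * (4 * N : ℝ) ^ m := by gcongr
    _ = |θ| * (4 * N : ℝ) ^ (m + 1) := by ring
    _ ≤ ((4 * N : ℝ) ^ (m + 1))⁻¹ * (4 * N : ℝ) ^ (m + 1) := by gcongr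
    _ = 1 := inv_mul_cancel₀ (by positivity)
end

section
/- Let L be an odd prime and N a natural number with 4N < L. Let A and B be subsets of {−(L−1)/2, …, (L−1)/2} with |A| = |B| = N, and define E_A = 2 Σ_{ν∈A} cos(2πν/L). Suppose there exists ν such that |A ∩ {ν, −ν}| ≠ |B ∩ {ν, −ν}|. Then |E_A − E_B| ≥ (4N)^{−(L−3)/2}. -/
open Finset

open Polynomial in
/-- If an integer polynomial vanishes at no primitive `n`-th root of unity, then the product of its
values at these roots has absolute value at least `1`. -/
theorem one_le_prod_norm_aeval_primitiveRoots {n : ℕ} [NeZero n] (f : ℤ[X])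
    (hf : ∀ μ ∈ primitiveRoots n ℂ, aeval μ f ≠ 0) :
    1 ≤ ∏ μ ∈ primitiveRoots n ℂ, ‖aeval μ f‖ := by
  have hres : ((resultant (cyclotomic n ℤ) f (cyclotomic n ℂ).natDegree f.natDegree : ℤ) : ℂ)
      = ∏ μ ∈ primitiveRoots n ℂ, aeval μ f := by
    have h := resultant_eq_prod_eval (cyclotomic n ℂ) (f.map (Int.castRingHom ℂ)) f.natDegree
      natDegree_map_le (IsAlgClosed.splits _)
    rw [← map_cyclotomic_int n ℂ, resultant_map_map, map_cyclotomic_int,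
      cyclotomic.roots_eq_primitiveRoots_val, (cyclotomic.monic n ℂ).leadingCoeff, one_pow,
      one_mul] at h
    exact h.trans (prod_congr rfl fun μ _ => eval_map_algebraMap f μ)
  rw [← norm_prod, ← hres, Complex.norm_intCast]
  have hne : resultant (cyclotomic n ℤ) f (cyclotomic n ℂ).natDegree f.natDegree ≠ 0 := by
    intro h0
    rw [h0, Int.cast_zero] at hres
    exact Finset.prod_ne_zero_iff.2 hf hres.symm
  exact_mod_cast Int.one_le_abs hne

open Polynomial in
/-- An integer polynomial of degree less than `p` that vanishes at `1` and at a primitive `p`-th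
root of unity is zero. -/
theorem eq_zero_of_aeval_primitiveRoot_eq_zero {p : ℕ} (hp : p.Prime) {f : ℤ[X]}
    (hdeg : f.natDegree < p) (hone : f.eval 1 = 0) {μ : ℂ} (hμ : IsPrimitiveRoot μ p)
    (hzero : aeval μ f = 0) : f = 0 := by
  have : Fact p.Prime := ⟨hp⟩
  obtain ⟨g, rfl⟩ : cyclotomic p ℤ ∣ f := by
    rw [cyclotomic_eq_minpoly hμ hp.pos]
    exact minpoly.isIntegrallyClosed_dvd (hμ.isIntegral hp.pos) hzero
  have hg : g.natDegree = 0 := by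
    by_cases hg0 : g = 0
    · simp [hg0]
    rw [(cyclotomic.monic p ℤ).natDegree_mul' hg0, natDegree_cyclotomic,
      Nat.totient_prime hp] at hdeg
    omega
  rw [eq_C_of_natDegree_eq_zero hg] at hone ⊢
  simp only [eval_mul, eval_one_cyclotomic_prime, eval_C, mul_eq_zero, Nat.cast_eq_zero,
    hp.ne_zero, false_or] at hone
  simp [hone]

open Polynomial in
/-- If an integer polynomial has no zero among the primitive `p`-th roots of unity, is bounded by
`M` there, and takes the same value at `ζ` and `ζ⁻¹`, then `‖f(ζ)‖` is at least
`(M ^ ((p - 3) / 2))⁻¹`. -/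
theorem inv_pow_le_norm_aeval_primitiveRoot {p : ℕ} (hp : p.Prime) (hodd : Odd p) {f : ℤ[X]}
    {M : ℝ} (hM : 0 < M) (hf : ∀ μ ∈ primitiveRoots p ℂ, aeval μ f ≠ 0)
    (hbound : ∀ μ ∈ primitiveRoots p ℂ, ‖aeval μ f‖ ≤ M) {ζ : ℂ} (hζ : IsPrimitiveRoot ζ p)
    (hinv : aeval ζ⁻¹ f = aeval ζ f) :
    (M ^ ((p - 3) / 2))⁻¹ ≤ ‖aeval ζ f‖ := by
  have : NeZero p := ⟨hp.ne_zero⟩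
  obtain ⟨k, rfl⟩ := hodd
  have hk : 1 ≤ k := by
    have := hp.two_le
    omega
  have hmem : ζ ∈ primitiveRoots (2 * k + 1) ℂ := (mem_primitiveRoots hp.pos).2 hζ
  have hmem' : ζ⁻¹ ∈ primitiveRoots (2 * k + 1) ℂ := (mem_primitiveRoots hp.pos).2 hζ.inv
  have hne : ζ⁻¹ ≠ ζ := by
    intro h
    have h2 : ζ ^ 2 = 1 := by
      rw [sq]
      nth_rewrite 1 [← h]
      exact inv_mul_cancel₀ (hζ.ne_zero hp.ne_zero)
    have := Nat.le_of_dvd two_pos (hζ.dvd_of_pow_eq_one 2 h2)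
    omega
  have hmem'' : ζ⁻¹ ∈ (primitiveRoots (2 * k + 1) ℂ).erase ζ := mem_erase.2 ⟨hne, hmem'⟩
  have hcard : (((primitiveRoots (2 * k + 1) ℂ).erase ζ).erase ζ⁻¹).card = 2 * (k - 1) := by
    rw [card_erase_of_mem hmem'', card_erase_of_mem hmem, Complex.card_primitiveRoots,
      Nat.totient_prime hp]
    omega
  have hprod := one_le_prod_norm_aeval_primitiveRoots f hf
  rw [← mul_prod_erase _ _ hmem, ← mul_prod_erase _ _ hmem'', hinv] at hprod
  have hle : ∏ μ ∈ ((primitiveRoots (2 * k + 1) ℂ).erase ζ).erase ζ⁻¹, ‖aeval μ f‖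
      ≤ M ^ (2 * (k - 1)) := by
    rw [← hcard, ← prod_const]
    exact prod_le_prod (fun _ _ => norm_nonneg _)
      fun μ hμ => hbound μ (mem_of_mem_erase (mem_of_mem_erase hμ))
  have hexp : (2 * k + 1 - 3) / 2 = k - 1 := by omega
  rw [hexp, inv_le_iff_one_le_mul₀ (by positivity)]
  have hsq : 1 ≤ (‖aeval ζ f‖ * M ^ (k - 1)) ^ 2 := by
    calc 1 ≤ _ := hprod
      _ ≤ ‖aeval ζ f‖ * (‖aeval ζ f‖ * M ^ (2 * (k - 1))) := by gcongr
      _ = _ := by ring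
  exact (one_le_sq_iff₀ (by positivity)).1 hsq

open Polynomial in
/-- The polynomial of degree less than `L` whose value at an `L`-th root of unity `μ` is
`∑ ν ∈ A, (μ ^ ν + μ ^ (-ν))`. -/
noncomputable def energyPoly (L : ℕ) (A : Finset ℤ) : ℤ[X] :=
  ∑ ν ∈ A, (X ^ (ν % L).toNat + X ^ (-ν % L).toNat)

namespace energyPoly

open Polynomial

variable {L : ℕ} (A : Finset ℤ)

theorem aeval_eq (hL : L ≠ 0) {μ : ℂ} (hμ : μ ^ L = 1) :
    aeval μ (energyPoly L A) = ∑ ν ∈ A, (μ ^ ν + μ ^ (-ν)) := by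
  have hμ0 : μ ≠ 0 := by
    rintro rfl
    simp [hL] at hμ
  have key : ∀ ν : ℤ, μ ^ (ν % L).toNat = μ ^ ν := by
    intro ν
    rw [← zpow_natCast, Int.toNat_of_nonneg (Int.emod_nonneg _ (by exact_mod_cast hL))]
    conv_rhs => rw [← Int.emod_add_mul_ediv ν L, zpow_add₀ hμ0, zpow_mul, zpow_natCast, hμ,
      one_zpow, mul_one]
  simp [energyPoly, key]

theorem eval_one : (energyPoly L A).eval 1 = 2 * A.card := by
  simp [energyPoly, eval_finsetSum, mul_comm]

theorem natDegree_lt (hL : 0 < L) : (energyPoly L A).natDegree < L := by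
  have hlt : ∀ ν : ℤ, (ν % L).toNat ≤ L - 1 := by
    intro ν
    have := Int.emod_lt_of_pos ν (b := L) (by exact_mod_cast hL)
    omega
  refine lt_of_le_of_lt (natDegree_sum_le_of_forall_le _ _ (n := L - 1) fun ν _ => ?_)
    (Nat.sub_lt hL one_pos)
  refine (natDegree_add_le _ _).trans (max_le ?_ ?_) <;> rw [natDegree_X_pow] <;> exact hlt _

theorem coeff_eq (hodd : Odd L)
    (hA : A ⊆ Finset.Icc (-(((L : ℤ) - 1) / 2)) (((L : ℤ) - 1) / 2)) {ν : ℤ}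
    (hν : ν ∈ Finset.Icc (-(((L : ℤ) - 1) / 2)) (((L : ℤ) - 1) / 2)) :
    (energyPoly L A).coeff (ν % L).toNat = ((A ∩ {ν}).card + (A ∩ {-ν}).card : ℕ) := by
  obtain ⟨k, rfl⟩ := hodd
  have key : ∀ a b : ℤ, -k ≤ a → a ≤ k → -k ≤ b → b ≤ k →
      ((a % (2 * k + 1 : ℕ)).toNat = (b % (2 * k + 1 : ℕ)).toNat ↔ a = b) := by
    intro a b h1 h2 h3 h4
    refine ⟨fun h => ?_, fun h => by rw [h]⟩
    have ha := Int.emod_nonneg a (b := ((2 * k + 1 : ℕ) : ℤ)) (by omega)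
    have hb := Int.emod_nonneg b (b := ((2 * k + 1 : ℕ) : ℤ)) (by omega)
    have hab : a % (2 * k + 1 : ℕ) = b % (2 * k + 1 : ℕ) := by omega
    have := Int.eq_zero_of_abs_lt_dvd (Int.ModEq.dvd hab.symm)
      (by rw [abs_lt]; omega)
    omega
  have hk : (((2 * k + 1 : ℕ) : ℤ) - 1) / 2 = k := by omega
  rw [hk] at hA hν
  obtain ⟨hν1, hν2⟩ := Finset.mem_Icc.1 hν
  have hsum : (energyPoly (2 * k + 1) A).coeff (ν % (2 * k + 1 : ℕ)).toNat
      = ∑ a ∈ A, ((if a = ν then 1 else 0) + (if a = -ν then 1 else 0)) := by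
    rw [energyPoly, finsetSum_coeff]
    refine sum_congr rfl fun a ha => ?_
    obtain ⟨h1, h2⟩ := Finset.mem_Icc.1 (hA ha)
    rw [coeff_add, coeff_X_pow, coeff_X_pow]
    congr 1
    · exact if_congr ((key ν a hν1 hν2 h1 h2).trans eq_comm) rfl rfl
    · exact if_congr ((key ν (-a) hν1 hν2 (by omega) (by omega)).trans (by omega)) rfl rfl
  have hcard : ∀ b : ℤ, ∑ a ∈ A, (if a = b then (1 : ℤ) else 0) = (A ∩ {b}).card := by
    intro b
    rw [sum_ite_eq', inter_singleton]
    split_ifs <;> rfl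
  rw [hsum, sum_add_distrib, hcard, hcard, Nat.cast_add]

end energyPoly

/-- Let `L` be an odd prime and `4N < L`. Let
`A, B ⊆ {-(L-1)/2, …, (L-1)/2}` with `|A| = |B| = N` and set
`E_A = 2 ∑_{ν∈A} cos(2πν/L)`. If there is a `ν` with
`|A ∩ {ν, -ν}| ≠ |B ∩ {ν, -ν}|` (i.e. `A` and `B` are not trivially degenerate),
then `|E_A − E_B| ≥ (4N)^{-(L-3)/2}`. -/
theorem energy_gap_of_not_trivially_degenerate
    (L N : ℕ) (hL : Nat.Prime L) (hodd : Odd L) (hN : 4 * N < L)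
    (A B : Finset ℤ)
    (hA : A ⊆ Finset.Icc (-(((L : ℤ) - 1) / 2)) (((L : ℤ) - 1) / 2))
    (hB : B ⊆ Finset.Icc (-(((L : ℤ) - 1) / 2)) (((L : ℤ) - 1) / 2))
    (hAcard : A.card = N) (hBcard : B.card = N)
    (hnontriv : ∃ ν : ℤ, (A ∩ ({ν, -ν} : Finset ℤ)).card ≠ (B ∩ ({ν, -ν} : Finset ℤ)).card) :
    |2 * ∑ ν ∈ A, Real.cos (2 * Real.pi * ν / L) -
      2 * ∑ ν ∈ B, Real.cos (2 * Real.pi * ν / L)| ≥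
      (((4 * N : ℕ) : ℝ) ^ ((L - 3) / 2 : ℕ))⁻¹ := by
  have hLpos := hL.pos
  have hN0 : N ≠ 0 := by
    rintro rfl
    rw [card_eq_zero] at hAcard hBcard
    simp [hAcard, hBcard] at hnontriv
  set f := energyPoly L A - energyPoly L B with hf
  have hf0 : f ≠ 0 := by
    intro h0
    obtain ⟨ν, hν⟩ := hnontriv
    have hmem : ν ∈ Finset.Icc (-(((L : ℤ) - 1) / 2)) (((L : ℤ) - 1) / 2) := by
      by_contra hout
      have hempty : ∀ S : Finset ℤ,
          S ⊆ Finset.Icc (-(((L : ℤ) - 1) / 2)) (((L : ℤ) - 1) / 2) → S ∩ {ν, -ν} = ∅ := by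
        intro S hS
        refine eq_empty_of_forall_notMem fun a ha => hout ?_
        obtain ⟨haS, ha⟩ := mem_inter.1 ha
        have haI := Finset.mem_Icc.1 (hS haS)
        rw [mem_insert, mem_singleton] at ha
        rw [Finset.mem_Icc]
        omega
      exact hν (by rw [hempty A hA, hempty B hB])
    have hcoeff := congrArg (fun g => Polynomial.coeff g (ν % L).toNat) (sub_eq_zero.1 h0)
    simp only [energyPoly.coeff_eq A hodd hA hmem, energyPoly.coeff_eq B hodd hB hmem,
      Nat.cast_inj] at hcoeff
    apply hν
    by_cases hν0 : ν = 0
    · subst hν0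
      simp only [neg_zero, pair_eq_singleton] at hcoeff ⊢
      omega
    · have hsplit : ∀ S : Finset ℤ,
          (S ∩ {ν, -ν}).card = (S ∩ {ν}).card + (S ∩ {-ν}).card := by
        intro S
        rw [← card_union_of_disjoint, ← inter_union_distrib_left, insert_eq]
        refine Disjoint.mono inter_subset_right inter_subset_right ?_
        rw [disjoint_singleton]
        omega
      rw [hsplit, hsplit, hcoeff]
  have heval : ∀ μ : ℂ, IsPrimitiveRoot μ L → Polynomial.aeval μ f =
      ∑ ν ∈ A, (μ ^ ν + μ ^ (-ν)) - ∑ ν ∈ B, (μ ^ ν + μ ^ (-ν)) := by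
    intro μ hμ
    rw [hf, map_sub, energyPoly.aeval_eq A hL.ne_zero hμ.pow_eq_one,
      energyPoly.aeval_eq B hL.ne_zero hμ.pow_eq_one]
  have hne : ∀ μ ∈ primitiveRoots L ℂ, Polynomial.aeval μ f ≠ 0 := by
    intro μ hμ h0
    refine hf0 (eq_zero_of_aeval_primitiveRoot_eq_zero hL ?_ ?_
      ((mem_primitiveRoots hLpos).1 hμ) h0)
    · exact (Polynomial.natDegree_sub_le _ _).trans_lt
        (max_lt (energyPoly.natDegree_lt A hLpos) (energyPoly.natDegree_lt B hLpos))
    · rw [hf, Polynomial.eval_sub, energyPoly.eval_one, energyPoly.eval_one, hAcard, hBcard,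
        sub_self]
  have hbound : ∀ μ ∈ primitiveRoots L ℂ, ‖Polynomial.aeval μ f‖ ≤ ((4 * N : ℕ) : ℝ) := by
    intro μ hμ
    rw [mem_primitiveRoots hLpos] at hμ
    have hnorm : ‖μ‖ = 1 := hμ.norm'_eq_one hL.ne_zero
    have hsum : ∀ S : Finset ℤ, ‖∑ ν ∈ S, (μ ^ ν + μ ^ (-ν))‖ ≤ S.card * (2 : ℝ) := by
      intro S
      rw [← nsmul_eq_mul]
      refine (norm_sum_le _ _).trans (sum_le_card_nsmul _ _ _ fun ν _ => ?_)
      refine (norm_add_le _ _).trans ?_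
      rw [norm_zpow, norm_zpow, hnorm, one_zpow, one_zpow]
      norm_num
    rw [heval μ hμ]
    refine (norm_sub_le _ _).trans ((add_le_add (hsum A) (hsum B)).trans (le_of_eq ?_))
    rw [hAcard, hBcard]
    push_cast
    ring
  have hζ := Complex.isPrimitiveRoot_exp L hL.ne_zero
  have hinv : Polynomial.aeval (Complex.exp (2 * Real.pi * Complex.I / L))⁻¹ f
      = Polynomial.aeval (Complex.exp (2 * Real.pi * Complex.I / L)) f := by
    rw [heval _ hζ.inv, heval _ hζ]
    simp only [inv_zpow', neg_neg, add_comm]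
  have hgap := inv_pow_le_norm_aeval_primitiveRoot hL hodd (by positivity) hne hbound hζ hinv
  have hcos : ∀ ν : ℤ, Complex.exp (2 * Real.pi * Complex.I / L) ^ ν
      + Complex.exp (2 * Real.pi * Complex.I / L) ^ (-ν)
      = ((2 * Real.cos (2 * Real.pi * ν / L) : ℝ) : ℂ) := by
    intro ν
    rw [← Complex.exp_int_mul, ← Complex.exp_int_mul]
    push_cast
    rw [Complex.two_cos]
    congr 2 <;> ring
  rw [heval _ hζ] at hgap
  simp only [hcos] at hgap
  rw [← Complex.ofReal_sum, ← Complex.ofReal_sum, ← Complex.ofReal_sub, Complex.norm_real,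
    Real.norm_eq_abs, ← mul_sum, ← mul_sum] at hgap
  exact hgap
end

section
/- For every real ρ with 0 < ρ ≤ 1/5, one has −(1−ρ)·log(1−ρ) + ((1−2ρ)/2)·log(1−2ρ) < (2/3)·ρ². -/
open Set

/-- A function vanishing at `0` with nonnegative derivative on `[0, a]` is nonnegative at `a`. -/
lemma nonneg_of_hasDerivAt_nonneg {f f' : ℝ → ℝ} {a : ℝ}
    (hf : ∀ x ∈ Icc 0 a, HasDerivAt f (f' x) x) (h0 : f 0 = 0)
    (hf' : ∀ x ∈ Icc 0 a, 0 ≤ f' x) (ha : 0 ≤ a) : 0 ≤ f a := by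
  have hmono : MonotoneOn f (Icc 0 a) :=
    monotoneOn_of_hasDerivWithinAt_nonneg (convex_Icc 0 a)
      (fun x hx => (hf x hx).continuousAt.continuousWithinAt)
      (fun x hx => (hf x (interior_subset hx)).hasDerivWithinAt)
      (fun x hx => hf' x (interior_subset hx))
  simpa [h0] using hmono (left_mem_Icc.2 ha) (right_mem_Icc.2 ha) ha

lemma hasDerivAt_log_one_sub {x : ℝ} (hx : x < 1) :
    HasDerivAt (fun y => Real.log (1 - y)) (-1 / (1 - x)) x :=
  ((hasDerivAt_id x).const_sub 1).log (sub_pos.2 hx).ne'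

lemma hasDerivAt_log_one_sub_two_mul {x : ℝ} (hx : x < 1 / 2) :
    HasDerivAt (fun y => Real.log (1 - 2 * y)) (-2 / (1 - 2 * x)) x := by
  have h : 1 - 2 * x ≠ 0 := by linarith
  simpa using (((hasDerivAt_id x).const_mul 2).const_sub 1).log h

lemma log_one_sub_sub_log_one_sub_two_mul_le {x : ℝ} (h0 : 0 ≤ x) (h1 : x ≤ 1 / 5) :
    Real.log (1 - x) - Real.log (1 - 2 * x) ≤ x + 3 / 2 * x ^ 2 + 9 / 2 * x ^ 3 := by
  have h := nonneg_of_hasDerivAt_nonneg (a := x)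
    (f := fun y => y + 3 / 2 * y ^ 2 + 9 / 2 * y ^ 3 -
      (Real.log (1 - y) - Real.log (1 - 2 * y)))
    (f' := fun y => 1 + 3 * y + 27 / 2 * y ^ 2 - (-1 / (1 - y) - -2 / (1 - 2 * y)))
    (fun y hy => by
      refine HasDerivAt.congr_deriv ((((hasDerivAt_id y).add ((hasDerivAt_pow 2 y).const_mul (3 / 2))).add
        ((hasDerivAt_pow 3 y).const_mul (9 / 2))).sub
        ((hasDerivAt_log_one_sub (x := y) (by linarith [hy.2])).sub
          (hasDerivAt_log_one_sub_two_mul (x := y) (by linarith [hy.2])))) ?_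
      norm_num
      ring)
    (by simp)
    (fun y hy => by
      have hy1 : y ≤ 1 / 5 := hy.2.trans h1
      have h2 : 0 < 1 - y := by linarith
      have h3 : 0 < 1 - 2 * y := by linarith
      have h2' := h2.ne'
      have h3' := h3.ne'
      have key : 1 + 3 * y + 27 / 2 * y ^ 2 - (-1 / (1 - y) - -2 / (1 - 2 * y)) =
          y ^ 2 * (13 / 2 - 69 / 2 * y + 27 * y ^ 2) / ((1 - y) * (1 - 2 * y)) := by
        rw [div_sub_div _ _ h2' h3', eq_div_iff (mul_ne_zero h2' h3'), sub_mul,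
          div_mul_cancel₀ _ (mul_ne_zero h2' h3')]
        ring
      have h4 : 0 ≤ 13 / 2 - 69 / 2 * y + 27 * y ^ 2 := by nlinarith [sq_nonneg (y - 1 / 5)]
      rw [key]
      positivity) h0
  exact sub_nonneg.1 h

lemma hasDerivAt_entropy_difference {x : ℝ} (hx : x < 1 / 2) :
    HasDerivAt (fun y => y ^ 2 / 2 + y ^ 3 / 2 + 9 / 8 * y ^ 4 -
        (-(1 - y) * Real.log (1 - y) + (1 - 2 * y) / 2 * Real.log (1 - 2 * y)))
      (x + 3 / 2 * x ^ 2 + 9 / 2 * x ^ 3 - (Real.log (1 - x) - Real.log (1 - 2 * x))) x := by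
  have h2 : 1 - x ≠ 0 := by linarith
  have h3 : 1 - 2 * x ≠ 0 := by linarith
  have hp := (((hasDerivAt_pow 2 x).div_const 2).add ((hasDerivAt_pow 3 x).div_const 2)).add
    ((hasDerivAt_pow 4 x).const_mul (9 / 8))
  have hl := (((hasDerivAt_id x).const_sub 1).neg.mul
    (hasDerivAt_log_one_sub (by linarith))).add
    (((((hasDerivAt_id x).const_mul 2).const_sub 1).div_const 2).mul
      (hasDerivAt_log_one_sub_two_mul hx))
  refine (hp.sub hl).congr_deriv ?_
  have h4 : (1 - x) * (-1 / (1 - x)) = -1 := mul_div_cancel₀ _ h2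
  have h5 : (1 - 2 * x) * (-2 / (1 - 2 * x)) = -2 := mul_div_cancel₀ _ h3
  simp only [Pi.neg_apply, id_eq]
  push_cast
  linear_combination h4 - h5 / 2

/-- For `0 < ρ ≤ 1/5`,
`-(1-ρ)log(1-ρ) + ((1-2ρ)/2)log(1-2ρ) < (2/3)ρ²`. -/
theorem entropy_difference_bound (ρ : ℝ) (h1 : 0 < ρ) (h2 : ρ ≤ 1 / 5) :
    -(1 - ρ) * Real.log (1 - ρ) + (1 - 2 * ρ) / 2 * Real.log (1 - 2 * ρ) <
      2 / 3 * ρ ^ 2 := by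
  have h := nonneg_of_hasDerivAt_nonneg
    (fun x hx => hasDerivAt_entropy_difference (x := x) (by linarith [hx.2])) (by simp)
    (fun x hx => by
      have := log_one_sub_sub_log_one_sub_two_mul_le hx.1 (hx.2.trans h2)
      linarith) h1.le
  have hρ : 0 < ρ ^ 2 := by positivity
  nlinarith [mul_pos hρ (show 0 < 1 / 6 - ρ / 2 - 9 / 8 * ρ ^ 2 by nlinarith)]
end

section
/- Let N ≥ 1 be a natural number. Then Σ over triples of permutations Q, P', Q' of {1,…,N} with Q ≠ id and P' ≠ Q' of sgn(Q)·sgn(P')·sgn(Q') · Π_{j=1}^{N} 𝟙[ j − Q(j) − P'(j) + Q'(j) ≡ 0 (mod N) ] equals N^N − N!. -/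
open Finset Equiv

/-- A sum over all self-maps of a finite type whose terms vanish at the non-injective maps is a sum
over permutations. -/
lemma Fintype.sum_eq_sum_perm_of_injective {α R : Type*} [Fintype α] [DecidableEq α]
    [AddCommMonoid R] (f : (α → α) → R) (hf : ∀ k, ¬ Function.Injective k → f k = 0) :
    ∑ k, f k = ∑ σ : Perm α, f σ := by
  symm
  refine Finset.sum_of_injOn (fun σ : Perm α => (σ : α → α)) ?_ ?_ ?_ ?_
  · exact DFunLike.coe_injective.injOn
  · intro σ _
    simp
  · intro k _ hk
    refine hf k fun hinj => hk ?_
    exact ⟨Equiv.ofBijective k (Finite.injective_iff_bijective.mp hinj), by simp, rfl⟩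
  · intro σ _
    rfl

namespace ZMod

variable (N : ℕ) [NeZero N]

/-- The matrix `ω ^ (c * k * a)` indexed by `k, a : ZMod N`, with `ω` a primitive `N`-th root of
unity. -/
noncomputable def charMatrix (c : ZMod N) : Matrix (ZMod N) (ZMod N) ℂ :=
  Matrix.of fun k a => stdAddChar (k * (c * a))

lemma charMatrix_mul_charMatrix_neg :
    charMatrix N 1 * charMatrix N (-1) = (N : ℂ) • (1 : Matrix (ZMod N) (ZMod N) ℂ) := by
  ext i j
  have h := AddChar.sum_mulShift (i - j) (isPrimitive_stdAddChar N)
  rw [Matrix.mul_apply, Matrix.smul_apply, Matrix.one_apply]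
  simp only [charMatrix, Matrix.of_apply, ← AddChar.map_add_eq_mul]
  rw [Finset.sum_congr rfl fun x _ => congrArg stdAddChar
    (show i * (1 * x) + x * (-1 * j) = x * (i - j) by ring), h]
  simp [sub_eq_zero, ZMod.card]

lemma det_charMatrix_mul_det_charMatrix_neg :
    (charMatrix N 1).det * (charMatrix N (-1)).det = (N : ℂ) ^ N := by
  rw [← Matrix.det_mul, charMatrix_mul_charMatrix_neg, Matrix.det_smul]
  simp [ZMod.card]

lemma det_submatrix_charMatrix (c : ZMod N) (k : ZMod N → ZMod N) :
    ((charMatrix N c).submatrix k id).det =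
      ∑ σ : Perm (ZMod N), (Perm.sign σ : ℂ) * ∏ j, stdAddChar (k j * (c * σ j)) := by
  rw [← Matrix.det_transpose, Matrix.det_apply']
  simp [charMatrix]

lemma pow_mul_prod_indicator (x : ZMod N → ZMod N) :
    (N : ℂ) ^ N * ∏ j, (if x j = 0 then (1 : ℂ) else 0) =
      ∑ k : ZMod N → ZMod N, ∏ j, stdAddChar (k j * x j) := by
  have h (b : ZMod N) : ∑ a : ZMod N, (stdAddChar (a * b) : ℂ) =
      (N : ℂ) * if b = 0 then 1 else 0 := by
    rw [AddChar.sum_mulShift b (isPrimitive_stdAddChar N)]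
    simp [ZMod.card]
  rw [← Fintype.piFinset_univ,
    ← Finset.prod_univ_sum (fun _ => univ) fun j a => (stdAddChar (a * x j) : ℂ)]
  simp only [h, Finset.prod_mul_distrib]
  simp [ZMod.card]

lemma sum_perm_sign_mul_indicator :
    ∑ Q : Perm (ZMod N), ∑ P : Perm (ZMod N), ∑ R : Perm (ZMod N),
      ((Perm.sign Q : ℤ) * (Perm.sign P : ℤ) * (Perm.sign R : ℤ)) *
        ∏ j, (if j - Q j - P j + R j = 0 then (1 : ℤ) else 0) = (N : ℤ) ^ N := by
  have hN : (N : ℂ) ^ N ≠ 0 := pow_ne_zero _ (Nat.cast_ne_zero.mpr (NeZero.ne N))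
  rw [← Int.cast_inj (α := ℂ)]
  refine mul_left_cancel₀ hN ?_
  push_cast
  set A := charMatrix N (-1) with hA
  set B := charMatrix N 1 with hB
  calc
    _ = ∑ Q : Perm (ZMod N), ∑ P : Perm (ZMod N), ∑ R : Perm (ZMod N),
          ∑ k : ZMod N → ZMod N, (∏ j, stdAddChar (k j * j)) *
            (((Perm.sign Q : ℂ) * ∏ j, stdAddChar (k j * (-1 * Q j))) *
            (((Perm.sign P : ℂ) * ∏ j, stdAddChar (k j * (-1 * P j))) *
            ((Perm.sign R : ℂ) * ∏ j, stdAddChar (k j * (1 * R j))))) := by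
      simp only [Finset.mul_sum]
      refine Finset.sum_congr rfl fun Q _ => Finset.sum_congr rfl fun P _ =>
        Finset.sum_congr rfl fun R _ => ?_
      rw [mul_left_comm, pow_mul_prod_indicator, Finset.mul_sum]
      refine Finset.sum_congr rfl fun k _ => ?_
      have h : ∏ j, (stdAddChar (k j * (j - Q j - P j + R j)) : ℂ) =
          (∏ j, stdAddChar (k j * j)) * (∏ j, stdAddChar (k j * (-1 * Q j))) *
            (∏ j, stdAddChar (k j * (-1 * P j))) * ∏ j, stdAddChar (k j * (1 * R j)) := by
        simp only [← Finset.prod_mul_distrib, ← AddChar.map_add_eq_mul]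
        refine Finset.prod_congr rfl fun j _ => congrArg _ (by ring)
      rw [h]
      ring
    _ = ∑ k : ZMod N → ZMod N, (∏ j, stdAddChar (k j * j)) *
          ((A.submatrix k id).det * ((A.submatrix k id).det * (B.submatrix k id).det)) := by
      refine Eq.trans (Finset.sum_congr rfl fun Q _ => (Finset.sum_congr rfl fun P _ =>
        Finset.sum_comm).trans Finset.sum_comm) (Finset.sum_comm.trans ?_)
      simp only [hA, hB, det_submatrix_charMatrix, ← Finset.mul_sum, ← Finset.sum_mul]
    _ = ∑ σ : Perm (ZMod N), (∏ j, stdAddChar (σ j * j)) *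
          ((A.submatrix σ id).det * ((A.submatrix σ id).det * (B.submatrix σ id).det)) := by
      refine Fintype.sum_eq_sum_perm_of_injective _ fun k hk => ?_
      obtain ⟨i, j, hij, hne⟩ := Function.not_injective_iff.mp hk
      rw [Matrix.det_zero_of_row_eq hne (M := A.submatrix k id)
        (by ext a; simp [hij])]
      simp
    _ = B.det * (A.det * (A.det * B.det)) := by
      have hdet : B.det = ∑ σ : Perm (ZMod N),
          (Perm.sign σ : ℂ) * ∏ j, stdAddChar (σ j * j) := by
        rw [Matrix.det_apply']
        simp [hB, charMatrix]
      rw [hdet, Finset.sum_mul, ← hdet]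
      refine Finset.sum_congr rfl fun σ _ => ?_
      simp only [Matrix.det_permute]
      obtain h | h := Int.units_eq_one_or (Perm.sign σ) <;> simp [h]
    _ = (N : ℂ) ^ N * (N : ℂ) ^ N := by
      rw [← det_charMatrix_mul_det_charMatrix_neg]
      ring

lemma sum_perm_sign_mul_indicator_of_ne :
    (∑ Q : Perm (ZMod N), ∑ P : Perm (ZMod N), ∑ R : Perm (ZMod N),
      if Q ≠ 1 ∧ P ≠ R then
        ((Perm.sign Q : ℤ) * (Perm.sign P : ℤ) * (Perm.sign R : ℤ)) *
          ∏ j, (if j - Q j - P j + R j = 0 then (1 : ℤ) else 0)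
      else 0) = (N : ℤ) ^ N - (N.factorial : ℤ) := by
  have key (Q P R : Perm (ZMod N)) :
      (if Q ≠ 1 ∧ P ≠ R then
        ((Perm.sign Q : ℤ) * (Perm.sign P : ℤ) * (Perm.sign R : ℤ)) *
          ∏ j, (if j - Q j - P j + R j = 0 then (1 : ℤ) else 0)
      else 0) =
      ((Perm.sign Q : ℤ) * (Perm.sign P : ℤ) * (Perm.sign R : ℤ)) *
          ∏ j, (if j - Q j - P j + R j = 0 then (1 : ℤ) else 0) -
        if Q = 1 then if P = R then 1 else 0 else 0 := by
    by_cases h : ∀ j, j - Q j - P j + R j = 0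
    · have hiff : Q = 1 ↔ P = R := by
        simp only [Equiv.ext_iff, Perm.one_apply]
        refine forall_congr' fun j => ?_
        have hj := h j
        constructor <;> intro e
        · linear_combination -hj - e
        · linear_combination -hj - e
      by_cases hPR : P = R
      · have hQ := hiff.mpr hPR
        subst hPR hQ
        obtain h' | h' := Int.units_eq_one_or (Perm.sign P) <;> simp [h']
      · simp [hPR, hiff]
    · obtain ⟨j, hj⟩ := not_forall.mp h
      have hprod : ∏ j, (if j - Q j - P j + R j = 0 then (1 : ℤ) else 0) = 0 :=
        Finset.prod_eq_zero (mem_univ j) (if_neg hj)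
      have hne : ¬ (Q = 1 ∧ P = R) := by
        rintro ⟨rfl, rfl⟩
        simp at hj
      rw [hprod]
      split_ifs <;> simp_all
  simp only [key, Finset.sum_sub_distrib, sum_perm_sign_mul_indicator]
  simp [Fintype.card_perm, ZMod.card]

end ZMod

/-- For `N ≥ 1`, the triple permutation sum over `Q ≠ id`, `P' ≠ Q'`
of `sgn(Q)·sgn(P')·sgn(Q')` times the indicator of
`j − Q(j) − P'(j) + Q'(j) ≡ 0 (mod N)` for all `j` equals `N^N − N!`. -/
theorem periodic_configuration_sum
    (N : ℕ) (hN : 1 ≤ N) :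
    (∑ Q : Equiv.Perm (Fin N), ∑ P' : Equiv.Perm (Fin N), ∑ Q' : Equiv.Perm (Fin N),
      if Q ≠ 1 ∧ P' ≠ Q' then
        ((Equiv.Perm.sign Q : ℤ) * (Equiv.Perm.sign P' : ℤ) * (Equiv.Perm.sign Q' : ℤ)) *
          ∏ j : Fin N,
            (if ((j : ℕ) : ZMod N) - ((Q j : ℕ) : ZMod N) - ((P' j : ℕ) : ZMod N) +
                ((Q' j : ℕ) : ZMod N) = 0 then (1 : ℤ) else 0)
      else 0) = (N : ℤ) ^ N - (N.factorial : ℤ) := by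
  obtain ⟨n, rfl⟩ : ∃ n, N = n + 1 := ⟨N - 1, by omega⟩
  have hcast (a : Fin (n + 1)) : ((a : ℕ) : ZMod (n + 1)) = a := Fin.cast_val_eq_self a
  simp only [hcast]
  exact ZMod.sum_perm_sign_mul_indicator_of_ne (n + 1)
end

section
/- Let N ≥ 1 and L ≥ 1, and let x : Fin N → ZMod L be a modular Golomb ruler, i.e., x is injective and for all indices j ≠ k and ℓ ≠ m, x(j) − x(k) = x(ℓ) − x(m) in ZMod L implies j = ℓ and k = m. Then for every permutation Q of Fin N with Q ≠ id, the number of ordered pairs (P', Q') of permutations of Fin N with P' ≠ Q' satisfying x(j) − x(Q(j)) − x(P'(j)) + x(Q'(j)) = 0 in ZMod L for all j equals n_Q!, where n_Q is the number of fixed points of Q. -/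
open Finset Equiv

/-- The permutations fixing every point outside `p` are counted by a factorial. -/
theorem card_perm_fixing_compl {α : Type*} [Fintype α] [DecidableEq α]
    (p : α → Prop) [DecidablePred p] :
    #{P : Perm α | ∀ a, ¬ p a → P a = a} = (#{a | p a}).factorial := by
  rw [← Fintype.card_subtype, ← Fintype.card_subtype, ← Fintype.card_perm]
  exact (Fintype.card_congr (Perm.subtypeEquivSubtypePerm p)).symm

/-- For a Golomb ruler, the pairs `(P, R)` solving the equation with `Q` are the pairs `(P, P * Q)`
with `P` supported on the fixed points of `Q`. -/
theorem golomb_equation_iff {α A : Type*} [AddCommGroup A] {x : α → A}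
    (hinj : Function.Injective x)
    (hG : ∀ j k l m : α, j ≠ k → l ≠ m → x j - x k = x l - x m → j = l ∧ k = m)
    (Q P R : Perm α) :
    (∀ j, x j - x (Q j) - x (P j) + x (R j) = 0) ↔
      (∀ j, Q j ≠ j → P j = j) ∧ R = P * Q := by
  have eqn (j : α) : x j - x (Q j) - x (P j) + x (R j) = 0 ↔
      x j - x (Q j) = x (P j) - x (R j) := by
    rw [← sub_eq_zero (a := x j - x (Q j)), sub_sub_eq_add_sub, sub_add_eq_add_sub]
  simp only [eqn]
  constructor
  · intro h
    have moved (j : α) (hj : Q j ≠ j) : P j = j ∧ R j = Q j := by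
      have hne : P j ≠ R j := fun e => hj <| hinj <| by
        have := h j
        rw [e, sub_self, sub_eq_zero] at this
        exact this.symm
      have := hG _ _ _ _ hj.symm hne (h j)
      exact ⟨this.1.symm, this.2.symm⟩
    refine ⟨fun j hj => (moved j hj).1, Equiv.ext fun j => ?_⟩
    rw [Perm.mul_apply]
    by_cases hj : Q j = j
    · have := h j
      rw [hj, sub_self, eq_comm, sub_eq_zero] at this
      rw [hj, hinj this]
    · rw [(moved j hj).2, (moved (Q j) fun e => hj (Q.injective e)).1]
  · rintro ⟨hP, rfl⟩ j
    rw [Perm.mul_apply]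
    by_cases hj : Q j = j
    · simp [hj]
    · rw [hP j hj, hP (Q j) fun e => hj (Q.injective e)]

/-- Let `x : Fin N → ZMod L` be a modular Golomb ruler. For every
permutation `Q ≠ id`, the number of ordered pairs `(P', Q')` of permutations with
`P' ≠ Q'` satisfying `x(j) − x(Q(j)) − x(P'(j)) + x(Q'(j)) = 0` for all `j` equals
`n_Q!`, where `n_Q` is the number of fixed points of `Q`. -/
theorem golomb_pair_count
    (N L : ℕ) (hN : 1 ≤ N) (hL : 1 ≤ L)
    (x : Fin N → ZMod L) (hinj : Function.Injective x)
    (hG : ∀ j k ℓ m : Fin N, j ≠ k → ℓ ≠ m →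
      x j - x k = x ℓ - x m → j = ℓ ∧ k = m)
    (Q : Equiv.Perm (Fin N)) (hQ : Q ≠ 1) :
    (Finset.univ.filter
        (fun PQ : Equiv.Perm (Fin N) × Equiv.Perm (Fin N) =>
          PQ.1 ≠ PQ.2 ∧ ∀ j : Fin N,
            x j - x (Q j) - x (PQ.1 j) + x (PQ.2 j) = 0)).card =
      (Finset.univ.filter (fun j : Fin N => Q j = j)).card.factorial := by
  rw [← card_perm_fixing_compl fun j => Q j = j]
  refine Finset.card_nbij' Prod.fst (fun P => (P, P * Q)) ?_ ?_ ?_ ?_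
  · rintro ⟨P, R⟩ h
    simp only [coe_filter, mem_univ, true_and, Set.mem_ofPred_eq,
      golomb_equation_iff hinj hG] at h ⊢
    exact h.2.1
  · intro P h
    simp only [coe_filter, mem_univ, true_and, Set.mem_ofPred_eq,
      golomb_equation_iff hinj hG] at h ⊢
    exact ⟨fun e => hQ (mul_eq_left.mp e.symm), h, trivial⟩
  · rintro ⟨P, R⟩ h
    simp only [coe_filter, mem_univ, true_and, Set.mem_ofPred_eq,
      golomb_equation_iff hinj hG] at h
    rw [h.2.2]
  · intro P _
    rfl
end

section
/- Let N ≥ 2 be a natural number. Then Σ over permutations Q of {1,…,N} with Q ≠ id of (fix Q)! is at most (N!/e)·(N − 3 + e), where fix Q denotes the number of fixed points of Q and e is Euler's number. -/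
open Finset Equiv

theorem card_perm_filter_fixed_eq {α : Type*} [Fintype α] [DecidableEq α] (s : Finset α) :
    #{f : Perm α | ({a | f a = a} : Finset α) = s} = numDerangements (Fintype.card α - #s) := by
  have hcard : Fintype.card {a // a ∉ s} = Fintype.card α - #s := by
    rw [Fintype.card_subtype_compl, Fintype.card_coe]
  rw [← hcard, ← card_derangements_eq_numDerangements,
    Fintype.card_congr (derangements.subtypeEquiv fun a => a ∉ s), Fintype.card_subtype]
  congr 1
  ext f
  simp only [Finset.ext_iff, mem_filter, mem_univ, true_and, not_not, Function.mem_fixedPoints,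
    Function.IsFixedPt]
  exact forall_congr' fun _ => iff_comm

theorem sum_perm_apply_card_fixed {α M : Type*} [Fintype α] [DecidableEq α] [AddCommMonoid M]
    (g : ℕ → M) :
    ∑ f : Perm α, g #{a | f a = a} = ∑ k ∈ range (Fintype.card α + 1),
      (Fintype.card α).choose k • numDerangements (Fintype.card α - k) • g k := by
  rw [← sum_fiberwise univ (fun f : Perm α => ({a | f a = a} : Finset α))]
  have hfiber (s : Finset α) : ∑ f : Perm α with ({a | f a = a} : Finset α) = s,
      g #{a | f a = a} = numDerangements (Fintype.card α - #s) • g #s := by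
    rw [← card_perm_filter_fixed_eq, ← sum_const]
    refine sum_congr rfl fun f hf => ?_
    rw [(mem_filter.mp hf).2]
  simp_rw [hfiber]
  rw [← powerset_univ,
    sum_powerset_apply_card fun k => numDerangements (Fintype.card α - k) • g k, card_univ]

theorem sum_perm_factorial_card_fixed (α : Type*) [Fintype α] [DecidableEq α] :
    ∑ f : Perm α, ((#{a | f a = a}).factorial : ℝ) = (Fintype.card α).factorial *
      ∑ m ∈ range (Fintype.card α + 1), (numDerangements m : ℝ) / m.factorial := by
  rw [sum_perm_apply_card_fixed fun k => (k.factorial : ℝ), ← sum_flip, mul_sum]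
  refine sum_congr rfl fun k hk => ?_
  have hle : k ≤ Fintype.card α := mem_range_succ_iff.mp hk
  rw [Nat.choose_symm hle, Nat.sub_sub_self hle, ← Nat.choose_mul_factorial_mul_factorial hle]
  push_cast [nsmul_eq_mul]
  field

theorem numDerangements_div_factorial_eq_sum (n : ℕ) :
    (numDerangements n : ℝ) / n.factorial =
      ∑ k ∈ range (n + 1), (-1 : ℝ) ^ k / k.factorial := by
  induction n with
  | zero => simp
  | succ n ih =>
    rw [sum_range_succ, ← ih, ← Int.cast_natCast, numDerangements_succ, Nat.factorial_succ]
    push_cast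
    field

theorem numDerangements_div_factorial_le (n : ℕ) :
    (numDerangements n : ℝ) / n.factorial ≤
      Real.exp (-1) + (n + 2) / ((n + 1).factorial * (n + 1)) := by
  have h := (abs_le.mp (Real.exp_bound (x := -1) (by simp) n.succ_pos)).1
  rw [← numDerangements_div_factorial_eq_sum] at h
  push_cast [abs_neg, abs_one, one_pow] at h
  have hn : (n : ℝ) + 1 + 1 = n + 2 := by ring
  rw [hn] at h
  linarith

theorem sum_numDerangements_div_factorial_le {n : ℕ} (hn : 3 ≤ n) :
    ∑ m ∈ range (n + 1), (numDerangements m : ℝ) / m.factorial ≤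
      2 + (n - 3) * Real.exp (-1) - 1 / n.factorial := by
  induction n, hn using Nat.le_induction with
  | base => norm_num [sum_range_succ, numDerangements, Nat.factorial]
  | succ n hn ih =>
    rw [sum_range_succ]
    have h := numDerangements_div_factorial_le (n + 1)
    have hstep : (((n + 1 : ℕ) : ℝ) + 2) / ((n + 1 + 1).factorial * ((n + 1 : ℕ) + 1)) ≤
        1 / n.factorial - 1 / (n + 1).factorial := by
      have h0 : (0 : ℝ) < n.factorial := by positivity
      have h3 : (3 : ℝ) ≤ n := by exact_mod_cast hn
      have hdiff : (1 : ℝ) / n.factorial - 1 / (n + 1).factorial =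
          n * (n + 2) ^ 2 / ((n + 2) * (n + 1) * n.factorial * (n + 2)) := by
        rw [Nat.factorial_succ]
        push_cast
        field
      have hden : ((n + 1 + 1).factorial : ℝ) * ((n + 1 : ℕ) + 1) =
          (n + 2) * (n + 1) * n.factorial * (n + 2) := by
        rw [Nat.factorial_succ, Nat.factorial_succ]
        push_cast
        ring
      rw [hdiff, hden]
      gcongr
      push_cast
      nlinarith [sq_nonneg (n : ℝ)]
    push_cast at h hstep ⊢
    linarith

/-- For `N ≥ 2`, `∑_{Q ≠ id} (fix Q)! ≤ (N!/e)(N − 3 + e)`, where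
the sum runs over permutations of `{1,…,N}`, `fix Q` is the number of fixed points of
`Q`, and `e` is Euler's number. -/
theorem sum_factorial_fixed_points_bound (N : ℕ) (hN : 2 ≤ N) :
    (∑ Q : Equiv.Perm (Fin N),
        if Q ≠ 1 then
          (((Finset.univ.filter (fun j : Fin N => Q j = j)).card.factorial : ℝ))
        else 0) ≤
      ((N.factorial : ℝ) / Real.exp 1) * ((N : ℝ) - 3 + Real.exp 1) := by
  have hsum : ∑ m ∈ range (N + 1), (numDerangements m : ℝ) / m.factorial ≤
      2 + (N - 3) * Real.exp (-1) := by
    rcases hN.eq_or_lt with rfl | hN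
    · have hexp : Real.exp (-1) ≤ 1 / 2 := by
        rw [Real.exp_neg, ← one_div]
        exact one_div_le_one_div_of_le two_pos (by linarith [Real.add_one_le_exp (1 : ℝ)])
      norm_num [sum_range_succ, numDerangements, Nat.factorial]
      linarith
    · have hpos : (0 : ℝ) ≤ 1 / N.factorial := by positivity
      linarith [sum_numDerangements_div_factorial_le hN]
  have htotal := sum_perm_factorial_card_fixed (Fin N)
  rw [Fintype.card_fin, ← add_sum_erase _ _ (mem_univ 1)] at htotal
  simp only [Perm.coe_one, id_eq, filter_true, card_univ, Fintype.card_fin] at htotal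
  rw [← sum_filter, filter_ne']
  have hrhs : (N.factorial : ℝ) / Real.exp 1 * (N - 3 + Real.exp 1) =
      N.factorial * (2 + (N - 3) * Real.exp (-1)) - N.factorial := by
    rw [Real.exp_neg]
    field
  rw [hrhs]
  linarith [mul_le_mul_of_nonneg_left hsum (Nat.cast_nonneg (α := ℝ) N.factorial)]
end

section
/- Let N > 2 be a prime and define x_j = 1 + 2N(j−1) + ((j−1)² mod N) for j = 1, …, N, where (m mod N) denotes the least nonnegative residue. Then x is a Golomb ruler: for all indices j ≠ k and ℓ ≠ m, x_j − x_k = x_ℓ − x_m implies j = ℓ and k = m. -/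
/-- If an odd prime `N` divides `a² + d² - b² - c²`, where `a + d = b + c` and all numbers
lie in `[0, N)`, then `a = b` or `a = c`. -/
theorem eq_or_eq_of_add_eq_of_prime_dvd_sq {N : ℕ} (hp : N.Prime) (hN : 2 < N)
    {a b c d : ℤ} (ha : 0 ≤ a ∧ a < N) (hb : 0 ≤ b ∧ b < N) (hc : 0 ≤ c ∧ c < N)
    (hadd : a + d = b + c) (hdvd : (N : ℤ) ∣ a ^ 2 + d ^ 2 - b ^ 2 - c ^ 2) :
    a = b ∨ a = c := by
  have hpZ : Prime (N : ℤ) := Nat.prime_iff_prime_int.mp hp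
  obtain rfl : d = b + c - a := by linarith
  have hfactor : a ^ 2 + (b + c - a) ^ 2 - b ^ 2 - c ^ 2 = 2 * ((a - b) * (a - c)) := by ring
  rw [hfactor] at hdvd
  rcases hpZ.dvd_or_dvd hdvd with h | h
  · have := Int.le_of_dvd (by norm_num) h
    omega
  · rcases hpZ.dvd_or_dvd h with h | h
    · exact Or.inl (sub_eq_zero.mp (Int.eq_zero_of_abs_lt_dvd h (abs_lt.mpr (by omega))))
    · exact Or.inr (sub_eq_zero.mp (Int.eq_zero_of_abs_lt_dvd h (abs_lt.mpr (by omega))))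

/-- (Erdős–Turán construction.) Let `N > 2` be a prime and set
`x_j = 1 + 2N(j−1) + ((j−1)² mod N)` for `j = 1,…,N` (here indexed by `j : Fin N`,
representing `j−1`). Then `x` is a Golomb ruler: all differences `x_j − x_k` with
`j ≠ k` are distinct. -/
theorem erdos_turan_golomb_ruler (N : ℕ) (hp : N.Prime) (hN : 2 < N) :
    ∀ j k ℓ m : Fin N, j ≠ k → ℓ ≠ m →
      ((1 + 2 * N * (j : ℕ) + ((j : ℕ) ^ 2 % N) : ℤ) -
        (1 + 2 * N * (k : ℕ) + ((k : ℕ) ^ 2 % N) : ℤ) =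
       (1 + 2 * N * (ℓ : ℕ) + ((ℓ : ℕ) ^ 2 % N) : ℤ) -
        (1 + 2 * N * (m : ℕ) + ((m : ℕ) ^ 2 % N) : ℤ)) →
      j = ℓ ∧ k = m := by
  intro j k ℓ m hjk _ h
  have hN0 : (0 : ℤ) < N := by omega
  have cast_mem (i : Fin N) : (0 : ℤ) ≤ (i : ℕ) ∧ ((i : ℕ) : ℤ) < N := by omega
  have mod_mem (i : Fin N) :
      0 ≤ ((i : ℕ) : ℤ) ^ 2 % N ∧ ((i : ℕ) : ℤ) ^ 2 % N < N :=
    ⟨Int.emod_nonneg _ hN0.ne', Int.emod_lt_of_pos _ hN0⟩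
  have hadd : ((j : ℕ) : ℤ) + (m : ℕ) = (k : ℕ) + (ℓ : ℕ) := by
    have := mod_mem j
    have := mod_mem k
    have := mod_mem ℓ
    have := mod_mem m
    apply le_antisymm <;> refine Int.lt_add_one_iff.mp ?_ <;>
      refine lt_of_mul_lt_mul_left ?_ (mul_pos two_pos hN0).le <;> linarith
  have hmod : ((j : ℕ) : ℤ) ^ 2 % N + ((m : ℕ) : ℤ) ^ 2 % N =
      ((k : ℕ) : ℤ) ^ 2 % N + ((ℓ : ℕ) : ℤ) ^ 2 % N := by
    linear_combination h - 2 * N * hadd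
  have hdvd : (N : ℤ) ∣
      ((j : ℕ) : ℤ) ^ 2 + ((m : ℕ) : ℤ) ^ 2 - ((k : ℕ) : ℤ) ^ 2 - ((ℓ : ℕ) : ℤ) ^ 2 := by
    rw [sub_sub]
    refine Int.ModEq.dvd (Int.ModEq.symm ?_)
    rw [Int.ModEq, Int.add_emod, hmod, ← Int.add_emod]
  have hne : ((j : ℕ) : ℤ) ≠ (k : ℕ) := by
    exact_mod_cast Fin.val_ne_of_ne hjk
  have hjl : ((j : ℕ) : ℤ) = (ℓ : ℕ) :=
    (eq_or_eq_of_add_eq_of_prime_dvd_sq hp hN (cast_mem j) (cast_mem k) (cast_mem ℓ)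
      hadd hdvd).resolve_left hne
  constructor <;> ext <;> omega
end
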